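/- arXiv:1307.0830 — 2 statements merged into one kernel-verified Lean document; each statement's English description precedes it below -/
import Mathlib

section
/- Let $T \subseteq \mathbb{R}^n$ be an $n$-dimensional simplex with vertices $\underline v_0, \dots, \underline v_n \in \mathbb{R}^n_{\geq 0}$ (not contained in a hyperplane), and let $X_1,\dots,X_n > 0$. Then $\int_T \frac{n!\, X_1\cdots X_n}{(1 + a_1 X_1 + \cdots + a_n X_n)^{n+1}}\, da_1\cdots da_n = \frac{\widehat{\mathrm{Vol}}(T)\, X_1\cdots X_n}{\prod_{\ell=0}^n (1 + \underline v_\ell \cdot \underline X)}$, where $\widehat{\mathrm{Vol}}(T) = n! \cdot \mathrm{Vol}(T)$ is the normalized (Euclidean) volume and $\underline v \cdot \underline X = v_1 X_1 + \cdots + v_n X_n$. -/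
open MeasureTheory Matrix

namespace SimplexProjective

variable {ι : Type*}

/-- The homogenization `(a, 1)` of a point `a`. -/
def homogenize (a : ι → ℝ) : ι ⊕ Unit → ℝ := Sum.elim a fun _ => 1

/-- The matrix whose columns are the homogenized vertices. -/
def vertexMatrix (v : ι ⊕ Unit → ι → ℝ) : Matrix (ι ⊕ Unit) (ι ⊕ Unit) ℝ :=
  Matrix.of fun i ℓ => homogenize (v ℓ) i

lemma homogenize_injective : Function.Injective (homogenize : (ι → ℝ) → ι ⊕ Unit → ℝ) :=
  fun _ _ h => funext fun i => congrFun h (Sum.inl i)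

variable [Fintype ι]

lemma mem_convexHull_range_iff (v : ι ⊕ Unit → ι → ℝ) (a : ι → ℝ) :
    a ∈ convexHull ℝ (Set.range v) ↔
      ∃ c : ι ⊕ Unit → ℝ, (∀ ℓ, 0 ≤ c ℓ) ∧ vertexMatrix v *ᵥ c = homogenize a := by
  have key (c : ι ⊕ Unit → ℝ) : vertexMatrix v *ᵥ c = homogenize a ↔
      ∑ ℓ, c ℓ = 1 ∧ ∑ ℓ, c ℓ • v ℓ = a := by
    simp only [funext_iff, Sum.forall, Matrix.mulVec, dotProduct, vertexMatrix, homogenize,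
      Matrix.of_apply, Sum.elim_inl, Sum.elim_inr, one_mul, forall_const, Finset.sum_apply,
      Pi.smul_apply, smul_eq_mul, mul_comm (v _ _)]
    exact and_comm
  simp only [key]
  constructor
  · intro h
    rw [convexHull_range_eq_exists_affineCombination] at h
    classical
    obtain ⟨s, w, hw, hw1, rfl⟩ := h
    refine ⟨fun ℓ => if ℓ ∈ s then w ℓ else 0, fun ℓ => ?_, ?_, ?_⟩
    · by_cases hℓ : ℓ ∈ s <;> simp [hℓ, hw]
    · rwa [Finset.sum_ite_mem, Finset.univ_inter]
    · simp only [ite_smul, zero_smul, Finset.sum_ite_mem, Finset.univ_inter,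
        s.affineCombination_eq_linear_combination v w hw1]
  · rintro ⟨c, hc, h1, rfl⟩
    exact (convex_convexHull ℝ _).sum_mem (fun ℓ _ => hc ℓ) h1
      fun ℓ _ => subset_convexHull ℝ _ ⟨ℓ, rfl⟩

lemma one_add_dotProduct_pos {v : ι ⊕ Unit → ι → ℝ} (X : ι → ℝ) (hw : ∀ ℓ, 0 < 1 + v ℓ ⬝ᵥ X)
    {a : ι → ℝ} (ha : a ∈ convexHull ℝ (Set.range v)) : 0 < 1 + a ⬝ᵥ X := by
  have hconv : Convex ℝ {a : ι → ℝ | 0 < 1 + a ⬝ᵥ X} := by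
    intro x hx y hy s t hs ht hst
    simp only [Set.mem_ofPred_eq, add_dotProduct, smul_dotProduct, smul_eq_mul] at *
    have : 1 + (s * x ⬝ᵥ X + t * y ⬝ᵥ X) = s * (1 + x ⬝ᵥ X) + t * (1 + y ⬝ᵥ X) := by
      linear_combination -hst
    rw [this]
    exact (convex_Ioi (0 : ℝ)) hx hy hs ht hst
  exact convexHull_min (by rintro _ ⟨ℓ, rfl⟩; exact hw ℓ) hconv ha

variable [DecidableEq ι]

lemma det_vertexMatrix_ne_zero {v : ι ⊕ Unit → ι → ℝ} (hv : AffineIndependent ℝ v) :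
    (vertexMatrix v).det ≠ 0 := by
  intro h
  obtain ⟨c, hc, h0⟩ := Matrix.exists_mulVec_eq_zero_iff.2 h
  apply hc
  rw [affineIndependent_iff] at hv
  funext ℓ
  refine hv Finset.univ c ?_ ?_ ℓ (Finset.mem_univ _)
  · simpa [Matrix.mulVec, dotProduct, vertexMatrix, homogenize] using congrFun h0 (Sum.inr ())
  · funext i
    simpa [Matrix.mulVec, dotProduct, vertexMatrix, homogenize, mul_comm]
      using congrFun h0 (Sum.inl i)

/-- The linear map scaling each homogenized vertex by the value there of `1 + X ⬝ᵥ ·`. -/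
noncomputable def scaling (v : ι ⊕ Unit → ι → ℝ) (X : ι → ℝ) :
    Matrix (ι ⊕ Unit) (ι ⊕ Unit) ℝ :=
  vertexMatrix v * diagonal (fun ℓ => 1 + v ℓ ⬝ᵥ X) * (vertexMatrix v)⁻¹

variable {v : ι ⊕ Unit → ι → ℝ} (X : ι → ℝ)

lemma det_scaling (hv : AffineIndependent ℝ v) :
    (scaling v X).det = ∏ ℓ, (1 + v ℓ ⬝ᵥ X) := by
  have h := det_vertexMatrix_ne_zero hv
  rw [scaling, det_mul, det_mul, det_diagonal, det_nonsing_inv, Ring.inverse_eq_inv']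
  field_simp

lemma scaling_mulVec_vertexMatrix_mulVec (hv : AffineIndependent ℝ v) (c : ι ⊕ Unit → ℝ) :
    scaling v X *ᵥ (vertexMatrix v *ᵥ c) =
      vertexMatrix v *ᵥ fun ℓ => (1 + v ℓ ⬝ᵥ X) * c ℓ := by
  have h : IsUnit (vertexMatrix v).det := (det_vertexMatrix_ne_zero hv).isUnit
  rw [mulVec_mulVec, scaling, Matrix.mul_assoc, Matrix.nonsing_inv_mul _ h, Matrix.mul_one,
    ← mulVec_mulVec]
  congr 1
  funext ℓ
  simp [mulVec_diagonal]

lemma scaling_inr (hv : AffineIndependent ℝ v) (j : Unit) :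
    scaling v X (Sum.inr j) = Sum.elim X fun _ => 1 := by
  have h : IsUnit (vertexMatrix v).det := (det_vertexMatrix_ne_zero hv).isUnit
  have h1 : (vertexMatrix v * diagonal (fun ℓ => 1 + v ℓ ⬝ᵥ X)) (Sum.inr j) =
      (Sum.elim X fun _ => 1) ᵥ* vertexMatrix v := by
    funext ℓ
    simp [mul_diagonal, vertexMatrix, homogenize, vecMul, dotProduct, mul_comm, add_comm]
  rw [scaling, Matrix.mul_apply_eq_vecMul, h1, vecMul_vecMul, Matrix.mul_nonsing_inv _ h,
    vecMul_one]

lemma scaling_mulVec_homogenize_inr (hv : AffineIndependent ℝ v) (a : ι → ℝ) (j : Unit) :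
    (scaling v X *ᵥ homogenize a) (Sum.inr j) = 1 + a ⬝ᵥ X := by
  simp [mulVec, scaling_inr X hv, homogenize, dotProduct, mul_comm, add_comm]

/-- The projective map induced by `scaling v X`. -/
noncomputable def projMap (v : ι ⊕ Unit → ι → ℝ) (X a : ι → ℝ) : ι → ℝ :=
  (1 + a ⬝ᵥ X)⁻¹ • fun i => (scaling v X *ᵥ homogenize a) (Sum.inl i)

lemma homogenize_projMap (hv : AffineIndependent ℝ v) {a : ι → ℝ} (ha : 1 + a ⬝ᵥ X ≠ 0) :
    homogenize (projMap v X a) = (1 + a ⬝ᵥ X)⁻¹ • (scaling v X *ᵥ homogenize a) := by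
  funext i
  rcases i with i | j
  · simp [homogenize, projMap]
  · rw [Pi.smul_apply, scaling_mulVec_homogenize_inr X hv, smul_eq_mul, inv_mul_cancel₀ ha]
    rfl

lemma injOn_projMap (hv : AffineIndependent ℝ v) (hw : ∀ ℓ, 0 < 1 + v ℓ ⬝ᵥ X) :
    Set.InjOn (projMap v X) (convexHull ℝ (Set.range v)) := by
  intro a ha b hb hab
  have ha' := (one_add_dotProduct_pos X hw ha).ne'
  have hb' := (one_add_dotProduct_pos X hw hb).ne'
  have hdet : IsUnit (scaling v X) := by
    rw [isUnit_iff_isUnit_det, det_scaling X hv]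
    exact (Finset.prod_pos fun ℓ _ => hw ℓ).ne'.isUnit
  have h := congrArg homogenize hab
  rw [homogenize_projMap X hv ha', homogenize_projMap X hv hb', ← mulVec_smul, ← mulVec_smul] at h
  have h' := mulVec_injective_of_isUnit hdet h
  have hL : (1 + a ⬝ᵥ X)⁻¹ = (1 + b ⬝ᵥ X)⁻¹ := by
    simpa [homogenize] using congrFun h' (Sum.inr ())
  rw [hL] at h'
  exact homogenize_injective (smul_right_injective _ (inv_ne_zero hb') h')

lemma image_projMap (hv : AffineIndependent ℝ v) (hw : ∀ ℓ, 0 < 1 + v ℓ ⬝ᵥ X) :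
    projMap v X '' convexHull ℝ (Set.range v) = convexHull ℝ (Set.range v) := by
  ext b
  constructor
  · rintro ⟨a, ha, rfl⟩
    have hL := one_add_dotProduct_pos X hw ha
    obtain ⟨c, hc, h⟩ := (mem_convexHull_range_iff v a).1 ha
    refine (mem_convexHull_range_iff v _).2
      ⟨(1 + a ⬝ᵥ X)⁻¹ • fun ℓ => (1 + v ℓ ⬝ᵥ X) * c ℓ, fun ℓ => ?_, ?_⟩
    · exact mul_nonneg (inv_nonneg.2 hL.le) (mul_nonneg (hw ℓ).le (hc ℓ))
    · rw [homogenize_projMap X hv hL.ne', mulVec_smul, ← h,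
        scaling_mulVec_vertexMatrix_mulVec X hv]
  · intro hb
    obtain ⟨c, hc, h⟩ := (mem_convexHull_range_iff v b).1 hb
    have hsum : ∑ ℓ, c ℓ = 1 := by
      simpa [mulVec, dotProduct, vertexMatrix, homogenize] using congrFun h (Sum.inr ())
    set d : ι ⊕ Unit → ℝ := fun ℓ => c ℓ / (1 + v ℓ ⬝ᵥ X) with hd
    have hd0 : ∀ ℓ, 0 ≤ d ℓ := fun ℓ => div_nonneg (hc ℓ) (hw ℓ).le
    have hs : 0 < ∑ ℓ, d ℓ := by
      refine (Finset.sum_nonneg fun ℓ _ => hd0 ℓ).lt_of_ne' fun h0 => ?_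
      rw [Finset.sum_eq_zero_iff_of_nonneg fun ℓ _ => hd0 ℓ] at h0
      have hc0 : ∀ ℓ, c ℓ = 0 := fun ℓ =>
        (div_eq_zero_iff.1 (h0 ℓ (Finset.mem_univ _))).resolve_right (hw ℓ).ne'
      simp [hc0] at hsum
    set s := ∑ ℓ, d ℓ with hsdef
    let a : ι → ℝ := fun i => (vertexMatrix v *ᵥ (s⁻¹ • d)) (Sum.inl i)
    have ha : vertexMatrix v *ᵥ (s⁻¹ • d) = homogenize a := by
      funext i
      rcases i with i | j
      · rfl
      · rw [mulVec_smul]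
        have : (vertexMatrix v *ᵥ d) (Sum.inr j) = s := by
          simp [mulVec, dotProduct, vertexMatrix, homogenize, hsdef]
        simp [this, homogenize, hs.ne']
    have hmem : a ∈ convexHull ℝ (Set.range v) :=
      (mem_convexHull_range_iff v a).2
        ⟨_, fun ℓ => mul_nonneg (inv_nonneg.2 hs.le) (hd0 ℓ), ha⟩
    have hA : scaling v X *ᵥ homogenize a = s⁻¹ • homogenize b := by
      rw [← ha, mulVec_smul, mulVec_smul, scaling_mulVec_vertexMatrix_mulVec X hv, ← h]
      congr 2
      funext ℓ
      have := (hw ℓ).ne'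
      simp only [hd]
      field_simp
    have hL : 1 + a ⬝ᵥ X = s⁻¹ := by
      rw [← scaling_mulVec_homogenize_inr X hv a (), hA]
      simp [homogenize]
    refine ⟨a, hmem, homogenize_injective ?_⟩
    rw [homogenize_projMap X hv (one_add_dotProduct_pos X hw hmem).ne', hA, hL, smul_smul,
      inv_mul_cancel₀ (inv_ne_zero hs.ne'), one_smul]

/-- The derivative of `projMap v X` at `a`. -/
noncomputable def projMapFDeriv (v : ι ⊕ Unit → ι → ℝ) (X a : ι → ℝ) : (ι → ℝ) →L[ℝ] (ι → ℝ) :=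
  LinearMap.toContinuousLinearMap (Matrix.toLin' ((1 + a ⬝ᵥ X)⁻¹ •
    ((scaling v X).toBlocks₁₁ - (1 + a ⬝ᵥ X)⁻¹ •
      vecMulVec (fun i => (scaling v X *ᵥ homogenize a) (Sum.inl i)) X)))

lemma hasFDerivAt_projMap {a : ι → ℝ} (ha : 1 + a ⬝ᵥ X ≠ 0) :
    HasFDerivAt (projMap v X) (projMapFDeriv v X a) a := by
  have h1 : HasFDerivAt (fun a : ι → ℝ => 1 + a ⬝ᵥ X)
      (LinearMap.toContinuousLinearMap (Fintype.linearCombination ℝ X)) a := by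
    have := (LinearMap.toContinuousLinearMap (Fintype.linearCombination ℝ X)).hasFDerivAt
      (x := a) |>.const_add 1
    simpa [Fintype.linearCombination_apply, dotProduct] using this
  have h2 : HasFDerivAt (fun (a : ι → ℝ) i => (scaling v X *ᵥ homogenize a) (Sum.inl i))
      (LinearMap.toContinuousLinearMap (Matrix.toLin' (scaling v X).toBlocks₁₁)) a := by
    have := (LinearMap.toContinuousLinearMap (Matrix.toLin'
      (scaling v X).toBlocks₁₁)).hasFDerivAt (x := a) |>.add_const
        (fun i => scaling v X (Sum.inl i) (Sum.inr ()))
    refine this.congr_of_eventuallyEq (.of_forall fun x => funext fun i => ?_)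
    simp [homogenize, mulVec, dotProduct, toBlocks₁₁]
  have h3 := ((hasDerivAt_inv ha).comp_hasFDerivAt a h1).smul h2
  refine h3.congr_fderiv ?_
  ext x i
  have hX : (vecMulVec (fun i => (scaling v X *ᵥ homogenize a) (Sum.inl i)) X *ᵥ x) i =
      (scaling v X *ᵥ homogenize a) (Sum.inl i) * Fintype.linearCombination ℝ X x := by
    simp [vecMulVec_mulVec, Fintype.linearCombination_apply, dotProduct, mul_comm]
  simp [projMapFDeriv, hX]
  field_simp
  ring

lemma det_projMapFDeriv (hv : AffineIndependent ℝ v) {a : ι → ℝ} (ha : 1 + a ⬝ᵥ X ≠ 0) :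
    (projMapFDeriv v X a).det =
      (∏ ℓ, (1 + v ℓ ⬝ᵥ X)) / (1 + a ⬝ᵥ X) ^ (Fintype.card ι + 1) := by
  set L := 1 + a ⬝ᵥ X with hLdef
  set M : ι → ℝ := fun i => (scaling v X *ᵥ homogenize a) (Sum.inl i) with hM
  have hmul : scaling v X * fromBlocks 1 (replicateCol Unit a) 0 1 =
      fromBlocks (scaling v X).toBlocks₁₁ (replicateCol Unit M) (replicateRow Unit X)
        (L • (1 : Matrix Unit Unit ℝ)) := by
    ext i j
    rcases i with i | i <;> rcases j with j | j <;>
      simp [Matrix.mul_apply, hM, hLdef, homogenize, mulVec, dotProduct, toBlocks₁₁,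
        scaling_inr X hv, Matrix.one_apply, mul_comm, add_comm]
  let _ : Invertible (L • (1 : Matrix Unit Unit ℝ)) :=
    ⟨L⁻¹ • 1, by simp [smul_smul, ha], by simp [smul_smul, ha]⟩
  have hdet := congrArg Matrix.det hmul
  have hinv : ⅟(L • (1 : Matrix Unit Unit ℝ)) = L⁻¹ • 1 := rfl
  have hvec : replicateCol Unit M * replicateRow Unit X = vecMulVec M X := by
    rw [vecMulVec_eq Unit]
  rw [det_mul, det_scaling X hv, det_fromBlocks_zero₂₁, det_fromBlocks₂₂, hinv] at hdet
  simp [-Fintype.prod_sum_type, hvec] at hdet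
  rw [hdet, projMapFDeriv, ContinuousLinearMap.det]
  rw [LinearMap.coe_toContinuousLinearMap, LinearMap.det_toLin', det_smul, ← hM, ← hLdef]
  generalize ((scaling v X).toBlocks₁₁ - L⁻¹ • vecMulVec M X).det = D
  rw [inv_pow]
  field_simp
  ring

/-- The integral over a simplex of the `-(n + 1)`-th power of a positive affine function. -/
theorem setIntegral_inv_pow (hv : AffineIndependent ℝ v) (hw : ∀ ℓ, 0 < 1 + v ℓ ⬝ᵥ X) :
    (∫ a in convexHull ℝ (Set.range v), ((1 + a ⬝ᵥ X) ^ (Fintype.card ι + 1))⁻¹) =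
      volume.real (convexHull ℝ (Set.range v)) / ∏ ℓ, (1 + v ℓ ⬝ᵥ X) := by
  have hmeas : MeasurableSet (convexHull ℝ (Set.range v)) :=
    ((Set.finite_range v).isCompact_convexHull ℝ).measurableSet
  have hP : 0 < ∏ ℓ, (1 + v ℓ ⬝ᵥ X) := Finset.prod_pos fun ℓ _ => hw ℓ
  have h := integral_image_eq_integral_abs_det_fderiv_smul volume hmeas
    (fun a ha => (hasFDerivAt_projMap (v := v) X
      (one_add_dotProduct_pos X hw ha).ne').hasFDerivWithinAt)
    (injOn_projMap X hv hw) (fun _ => (1 : ℝ))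
  rw [image_projMap X hv hw, setIntegral_const, smul_eq_mul, mul_one] at h
  rw [h, eq_div_iff hP.ne', ← integral_mul_const]
  refine setIntegral_congr_fun hmeas fun a ha => ?_
  have hL := one_add_dotProduct_pos X hw ha
  simp only [det_projMapFDeriv X hv hL.ne', abs_of_pos (div_pos hP (pow_pos hL _)), smul_eq_mul]
  field_simp

end SimplexProjective

theorem simplex_contribution_finite (n : ℕ) (hn : 1 ≤ n)
    (v : Fin (n + 1) → Fin n → ℝ)
    (hv0 : ∀ ℓ i, 0 ≤ v ℓ i) (hind : AffineIndependent ℝ v)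
    (X : Fin n → ℝ) (hX : ∀ i, 0 < X i) :
    ∫ a in convexHull ℝ (Set.range v),
      ((n.factorial : ℝ) * ∏ i, X i) / (1 + ∑ i, a i * X i) ^ (n + 1)
    = ((n.factorial : ℝ) * (volume (convexHull ℝ (Set.range v))).toReal * ∏ i, X i) /
        ∏ ℓ, (1 + ∑ i, v ℓ i * X i) := by
  let e : Fin n ⊕ Unit ≃ Fin (n + 1) := Fintype.equivOfCardEq (by simp)
  have hrange : Set.range (v ∘ e) = Set.range v := e.surjective.range_comp v
  have hw (ℓ) : 0 < 1 + (v ∘ e) ℓ ⬝ᵥ X :=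
    add_pos_of_pos_of_nonneg one_pos
      (Finset.sum_nonneg fun i _ => mul_nonneg (hv0 _ i) (hX i).le)
  have h := SimplexProjective.setIntegral_inv_pow X
    ((affineIndependent_equiv e).2 hind : AffineIndependent ℝ (v ∘ e)) hw
  have hprod : ∏ ℓ, (1 + (v ∘ e) ℓ ⬝ᵥ X) = ∏ ℓ, (1 + v ℓ ⬝ᵥ X) :=
    e.prod_comp fun ℓ => 1 + v ℓ ⬝ᵥ X
  rw [hrange, hprod, Fintype.card_fin] at h
  simp only [div_eq_mul_inv _ ((_ : ℝ) ^ (n + 1)), integral_const_mul]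
  simp only [dotProduct, Measure.real] at h
  rw [h]
  ring
end

section
/- Let $T \subseteq \mathbb{R}^n$ be a simplex with finite vertices $\underline v_0,\dots,\underline v_r \in \mathbb{R}^n_{\geq 0}$ and infinite vertices in coordinate directions $e_{i_1},\dots,e_{i_{n-r}}$ (distinct indices), i.e., $T = \{\sum_{\ell=0}^r \lambda_\ell \underline v_\ell + \sum_{j=1}^{n-r} \mu_j e_{i_j} : \lambda_\ell \geq 0, \mu_j \geq 0, \sum_\ell \lambda_\ell = 1\}$. Assume $T$ is $n$-dimensional. Then for all $X_1,\dots,X_n > 0$: $\int_T \frac{n!\, X_1\cdots X_n}{(1 + \sum_i a_i X_i)^{n+1}}\, da = \frac{\widehat{\mathrm{Vol}}(T)\, X_1\cdots X_n}{\prod_{\ell=0}^r (1 + \underline v_\ell \cdot \underline X)\, \prod_{j=1}^{n-r} X_{i_j}}$, where $\widehat{\mathrm{Vol}}(T)$ is the normalized volume of the projection of $T$ along the directions $e_{i_1},\dots,e_{i_{n-r}}$. -/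
open MeasureTheory

theorem lintegral_pow_mul_exp_neg_mul_Ioi (n : ℕ) {c : ℝ} (hc : 0 < c) :
    ∫⁻ t in Set.Ioi (0 : ℝ), ENNReal.ofReal (t ^ n * Real.exp (-(c * t))) =
      ENNReal.ofReal ((n.factorial : ℝ) / c ^ (n + 1)) := by
  have key : ∫ t in Set.Ioi (0 : ℝ), t ^ n * Real.exp (-(c * t)) =
      (n.factorial : ℝ) / c ^ (n + 1) := by
    have h := Real.integral_rpow_mul_exp_neg_mul_Ioi (a := (n : ℝ) + 1) (by positivity) hc
    simp only [add_sub_cancel_right, Real.rpow_natCast, Real.Gamma_nat_eq_factorial] at h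
    rw [h, ← Nat.cast_succ, Real.rpow_natCast, one_div, inv_pow]
    field_simp
  rw [← key, ofReal_integral_eq_lintegral_ofReal]
  · exact .of_integral_ne_zero (by rw [key]; positivity)
  · filter_upwards [ae_restrict_mem measurableSet_Ioi] with t ht
    have : 0 < t := ht
    positivity

theorem lintegral_orthant_exp_neg_sum {ι : Type*} [Fintype ι] {h : ι → ℝ} (hh : ∀ k, 0 < h k) :
    ∫⁻ l in Set.univ.pi fun _ : ι => Set.Ioi (0 : ℝ), ENNReal.ofReal (Real.exp (-∑ k, l k * h k)) =
      ENNReal.ofReal (∏ k, (h k))⁻¹ := by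
  have hint : ∀ k, ∫ x in Set.Ioi (0 : ℝ), Real.exp (-h k * x) = (h k)⁻¹ := fun k => by
    rw [integral_exp_mul_Ioi (by linarith [hh k])]
    simp [neg_div_neg_eq]
  have hprod : ∀ l : ι → ℝ, Real.exp (-∑ k, l k * h k) = ∏ k, Real.exp (-h k * l k) := fun l => by
    rw [← Real.exp_sum, ← Finset.sum_neg_distrib]
    congr 1
    exact Finset.sum_congr rfl fun k _ => by ring
  simp_rw [hprod]
  rw [volume_pi, Measure.restrict_pi_pi, ← ofReal_integral_eq_lintegral_ofReal,
    integral_fintype_prod_eq_prod (fun k x => Real.exp (-h k * x))]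
  · simp_rw [hint, Finset.prod_inv_distrib]
  · have hi : ∀ k, Integrable (fun x => Real.exp (-h k * x)) (volume.restrict (Set.Ioi 0)) :=
      fun k => .of_integral_ne_zero (by rw [hint]; exact (inv_pos.2 (hh k)).ne')
    exact Integrable.fintype_prod hi
  · exact .of_forall fun l => by positivity

theorem lintegral_comp_smul_pi (n : ℕ) (g : (Fin n → ℝ) → ENNReal) (hg : Measurable g) {t : ℝ}
    (ht : 0 < t) : ∫⁻ b, g b = ENNReal.ofReal (t ^ n) * ∫⁻ a, g (t • a) := by
  have h := lintegral_map (μ := (volume : Measure (Fin n → ℝ))) hg (measurable_const_smul t)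
  rw [show (fun x : Fin n → ℝ => t • x) = (t • ·) from rfl, Measure.map_addHaar_smul _ ht.ne',
    lintegral_smul_measure, Module.finrank_fin_fun] at h
  rw [← h, smul_eq_mul, ← mul_assoc, ← ENNReal.ofReal_mul (by positivity),
    abs_of_pos (by positivity), mul_inv_cancel₀ (by positivity), ENNReal.ofReal_one, one_mul]

/-- The integral of `n! / (1 + ⟨a, X⟩) ^ (n + 1)` over `T` equals the integral of
`exp (-(t + ⟨b, X⟩))` over the cone spanned by `{1} × T`. -/
theorem setLIntegral_eq_lintegral_cone (n : ℕ) (X : Fin n → ℝ) {T : Set (Fin n → ℝ)}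
    (hT : MeasurableSet T) (hpos : ∀ a ∈ T, 0 < 1 + ∑ i, a i * X i) :
    ∫⁻ a in T, ENNReal.ofReal ((n.factorial : ℝ) / (1 + ∑ i, a i * X i) ^ (n + 1)) =
      ∫⁻ y : Fin (n + 1) → ℝ,
        ({y | 0 < y 0 ∧ (y 0)⁻¹ • Fin.tail y ∈ T} : Set (Fin (n + 1) → ℝ)).indicator
          (fun y => ENNReal.ofReal (Real.exp (-(y 0 + ∑ i, y (Fin.succ i) * X i)))) y := by
  have he := (volume_preserving_piFinSuccAbove (fun _ : Fin (n + 1) => ℝ) 0).symm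
  set F : ℝ → (Fin n → ℝ) → ENNReal := fun t b =>
    (Set.Ioi (0 : ℝ)).indicator (fun t => T.indicator
      (fun _ => ENNReal.ofReal (Real.exp (-(t + ∑ i, b i * X i)))) (t⁻¹ • b)) t with hF
  have hset : MeasurableSet {q : ℝ × (Fin n → ℝ) | 0 < q.1 ∧ q.1⁻¹ • q.2 ∈ T} := by
    refine (measurableSet_lt measurable_const measurable_fst).inter ?_
    exact (show Measurable fun q : ℝ × (Fin n → ℝ) => q.1⁻¹ • q.2 by fun_prop) hT
  have hFm : Measurable (Function.uncurry F) := by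
    have : Function.uncurry F = {q : ℝ × (Fin n → ℝ) | 0 < q.1 ∧ q.1⁻¹ • q.2 ∈ T}.indicator
        fun q => ENNReal.ofReal (Real.exp (-(q.1 + ∑ i, q.2 i * X i))) := by
      ext ⟨t, b⟩
      by_cases h1 : 0 < t <;> by_cases h2 : t⁻¹ • b ∈ T <;> simp [hF, h1, h2]
    rw [this]
    exact Measurable.indicator (by fun_prop) hset
  have hR : ∫⁻ y : Fin (n + 1) → ℝ,
        ({y | 0 < y 0 ∧ (y 0)⁻¹ • Fin.tail y ∈ T} : Set (Fin (n + 1) → ℝ)).indicator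
          (fun y => ENNReal.ofReal (Real.exp (-(y 0 + ∑ i, y (Fin.succ i) * X i)))) y =
      ∫⁻ t, ∫⁻ b, F t b := by
    have hp := lintegral_prod (μ := (volume : Measure ℝ))
      (ν := (volume : Measure (Fin n → ℝ))) _ hFm.aemeasurable
    simp only [Function.uncurry_apply_pair] at hp
    rw [← hp, ← Measure.volume_eq_prod, he.lintegral_map_equiv]
    refine lintegral_congr fun ⟨t, b⟩ => ?_
    by_cases h1 : 0 < t <;> by_cases h2 : t⁻¹ • b ∈ T <;>
      simp [hF, h1, h2, MeasurableEquiv.piFinSuccAbove_symm_apply, Fin.insertNthEquiv]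
  rw [hR]
  calc ∫⁻ a in T, ENNReal.ofReal ((n.factorial : ℝ) / (1 + ∑ i, a i * X i) ^ (n + 1))
      = ∫⁻ a in T, ∫⁻ t in Set.Ioi (0 : ℝ),
          ENNReal.ofReal (t ^ n * Real.exp (-((1 + ∑ i, a i * X i) * t))) :=
        setLIntegral_congr_fun hT fun a ha =>
          (lintegral_pow_mul_exp_neg_mul_Ioi n (hpos a ha)).symm
    _ = ∫⁻ t in Set.Ioi (0 : ℝ), ∫⁻ a in T,
          ENNReal.ofReal (t ^ n * Real.exp (-((1 + ∑ i, a i * X i) * t))) := by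
        rw [lintegral_lintegral_swap]
        exact Measurable.aemeasurable (by fun_prop)
    _ = ∫⁻ t in Set.Ioi (0 : ℝ), ∫⁻ b, F t b := by
        refine setLIntegral_congr_fun measurableSet_Ioi fun t ht => ?_
        have ht : 0 < t := ht
        rw [lintegral_comp_smul_pi n (F t) (hFm.comp measurable_prodMk_left) ht,
          ← lintegral_const_mul' _ _ ENNReal.ofReal_ne_top, ← lintegral_indicator hT]
        refine lintegral_congr fun a => ?_
        by_cases ha : a ∈ T
        · simp only [hF, ha, Set.indicator_of_mem, Set.mem_Ioi, ht, smul_smul,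
            inv_mul_cancel₀ ht.ne', one_smul, Pi.smul_apply, smul_eq_mul]
          rw [ENNReal.ofReal_mul (by positivity), add_mul, Finset.sum_mul, one_mul]
          congr 6
          ext i
          ring
        · simp [hF, ha, ht, smul_smul, inv_mul_cancel₀ ht.ne']
    _ = ∫⁻ t, ∫⁻ b, F t b := by
        rw [← lintegral_indicator measurableSet_Ioi]
        refine lintegral_congr fun t => ?_
        by_cases ht : 0 < t <;> simp [hF, ht]

theorem exists_nonneg_mulVec_eq_iff {ι : Type*} [Fintype ι] [DecidableEq ι] {G : Matrix ι ι ℝ}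
    (hG : G.det ≠ 0) (y : ι → ℝ) :
    (∃ l : ι → ℝ, (∀ k, 0 ≤ l k) ∧ G.mulVec l = y) ↔ ∀ k, 0 ≤ (G⁻¹.mulVec y) k := by
  have hu : IsUnit G.det := isUnit_iff_ne_zero.2 hG
  constructor
  · rintro ⟨l, hl, rfl⟩
    simpa [Matrix.mulVec_mulVec, Matrix.nonsing_inv_mul _ hu] using hl
  · intro h
    exact ⟨_, h, by simp [Matrix.mulVec_mulVec, Matrix.mul_nonsing_inv _ hu]⟩

theorem lintegral_mulVec {ι : Type*} [Fintype ι] [DecidableEq ι] {G : Matrix ι ι ℝ}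
    (hG : G.det ≠ 0) {f : (ι → ℝ) → ENNReal} (hf : Measurable f) :
    ∫⁻ y, f y = ENNReal.ofReal |G.det| * ∫⁻ l, f (G.mulVec l) := by
  have h := lintegral_map (μ := (volume : Measure (ι → ℝ))) hf
    (Matrix.toLin' G).continuous_of_finiteDimensional.measurable
  rw [Real.map_matrix_volume_pi_eq_smul_volume_pi hG, lintegral_smul_measure] at h
  simp only [Matrix.toLin'_apply] at h
  rw [← h, smul_eq_mul, ← mul_assoc, ← ENNReal.ofReal_mul (abs_nonneg _), ← abs_mul,
    mul_inv_cancel₀ hG, abs_one, ENNReal.ofReal_one, one_mul]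

/-- The integral of `n! / (1 + ⟨a, X⟩) ^ (n + 1)` over the slice at height `1` of the cone spanned by
the columns of `G`. -/
theorem integral_slice_simplicial_cone (n : ℕ) {G : Matrix (Fin (n + 1)) (Fin (n + 1)) ℝ}
    (hG : G.det ≠ 0) (hG0 : ∀ k, 0 ≤ G 0 k) (X : Fin n → ℝ)
    (hX : ∀ k, 0 < G 0 k + ∑ i, G (Fin.succ i) k * X i) {T : Set (Fin n → ℝ)}
    (hT : ∀ a, a ∈ T ↔ ∃ l : Fin (n + 1) → ℝ,
      (∀ k, 0 ≤ l k) ∧ G.mulVec l = (Fin.cons 1 a : Fin (n + 1) → ℝ)) :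
    ∫ a in T, (n.factorial : ℝ) / (1 + ∑ i, a i * X i) ^ (n + 1) =
      |G.det| / ∏ k, (G 0 k + ∑ i, G (Fin.succ i) k * X i) := by
  set h : Fin (n + 1) → ℝ := fun k => G 0 k + ∑ i, G (Fin.succ i) k * X i with hh
  have hpair : ∀ l : Fin (n + 1) → ℝ,
      G.mulVec l 0 + ∑ i, G.mulVec l (Fin.succ i) * X i = ∑ k, l k * h k := fun l => by
    simp only [hh, Matrix.mulVec, dotProduct, mul_add, Finset.sum_add_distrib, Finset.sum_mul,
      Finset.mul_sum]
    rw [Finset.sum_comm]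
    congr 1
    · exact Finset.sum_congr rfl fun _ _ => mul_comm _ _
    · exact Finset.sum_congr rfl fun _ _ => Finset.sum_congr rfl fun _ _ => by ring
  obtain ⟨k₀, hk₀⟩ : ∃ k, G 0 k ≠ 0 := by
    by_contra! hc
    exact hG (Matrix.det_eq_zero_of_row_eq_zero 0 hc)
  have hTm : MeasurableSet T := by
    have : T = ⋂ k, {a | 0 ≤ (G⁻¹.mulVec (Fin.cons 1 a : Fin (n + 1) → ℝ)) k} := by
      ext a
      rw [hT, exists_nonneg_mulVec_eq_iff hG, Set.mem_iInter]
      rfl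
    rw [this]
    refine MeasurableSet.iInter fun k => (isClosed_le continuous_const ?_).measurableSet
    simp only [Matrix.mulVec, dotProduct, Fin.sum_univ_succ, Fin.cons_zero, Fin.cons_succ]
    fun_prop
  have hpos : ∀ a ∈ T, 0 < 1 + ∑ i, a i * X i := fun a ha => by
    obtain ⟨l, hl, hla⟩ := (hT a).1 ha
    have h1 := hpair l
    rw [hla] at h1
    simp only [Fin.cons_zero, Fin.cons_succ] at h1
    rw [h1]
    refine lt_of_le_of_ne (Finset.sum_nonneg fun k _ => mul_nonneg (hl k) (hX k).le) fun h0 => ?_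
    have h2 := (Finset.sum_eq_zero_iff_of_nonneg
      fun k _ => mul_nonneg (hl k) (hX k).le).1 h0.symm
    have h3 : l = 0 := by
      ext k
      exact (mul_eq_zero.1 (h2 k (Finset.mem_univ k))).resolve_right (hX k).ne'
    have h4 := congrFun hla 0
    simp [h3] at h4
  have hcone : ∀ l : Fin (n + 1) → ℝ, (∀ k, l k ≠ 0) →
      ((0 < G.mulVec l 0 ∧ (G.mulVec l 0)⁻¹ • Fin.tail (G.mulVec l) ∈ T) ↔ ∀ k, 0 < l k) := by
    intro l hl
    have hcons : 0 < G.mulVec l 0 → (Fin.cons 1 ((G.mulVec l 0)⁻¹ • Fin.tail (G.mulVec l)) :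
        Fin (n + 1) → ℝ) = G.mulVec ((G.mulVec l 0)⁻¹ • l) := fun h0 => by
      rw [Matrix.mulVec_smul]
      ext i
      refine Fin.cases ?_ (fun i => ?_) i
      · simp [h0.ne']
      · simp [Fin.tail]
    constructor
    · rintro ⟨h0, hmem⟩ k
      rw [hT, hcons h0, exists_nonneg_mulVec_eq_iff hG] at hmem
      have := hmem k
      rw [Matrix.mulVec_mulVec, Matrix.nonsing_inv_mul _ (isUnit_iff_ne_zero.2 hG),
        Matrix.one_mulVec, Pi.smul_apply, smul_eq_mul, mul_nonneg_iff_of_pos_left (inv_pos.2 h0)]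
        at this
      exact this.lt_of_ne' (hl k)
    · intro hlp
      have h0 : 0 < G.mulVec l 0 :=
        Finset.sum_pos' (fun k _ => mul_nonneg (hG0 k) (hlp k).le)
          ⟨k₀, Finset.mem_univ _, mul_pos ((hG0 k₀).lt_of_ne' hk₀) (hlp k₀)⟩
      exact ⟨h0, (hT _).2 ⟨_, fun k => mul_nonneg (inv_pos.2 h0).le (hlp k).le, (hcons h0).symm⟩⟩
  have hCm : MeasurableSet {y : Fin (n + 1) → ℝ | 0 < y 0 ∧ (y 0)⁻¹ • Fin.tail y ∈ T} := by
    refine (measurableSet_lt measurable_const (measurable_pi_apply 0)).inter ?_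
    have : Measurable fun y : Fin (n + 1) → ℝ => (y 0)⁻¹ • Fin.tail y := by
      unfold Fin.tail
      fun_prop
    exact this hTm
  rw [integral_eq_lintegral_of_nonneg_ae, setLIntegral_eq_lintegral_cone n X hTm hpos,
    lintegral_mulVec hG (Measurable.indicator (by fun_prop) hCm)]
  · have hae : ∀ᵐ l : Fin (n + 1) → ℝ, ∀ k, l k ≠ 0 :=
      ae_all_iff.2 fun k => Measure.ae_eval_ne _ k 0
    rw [lintegral_congr_ae (g := (Set.univ.pi fun _ => Set.Ioi (0 : ℝ)).indicator
        fun l => ENNReal.ofReal (Real.exp (-∑ k, l k * h k))), lintegral_indicator,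
      lintegral_orthant_exp_neg_sum hX, ENNReal.toReal_mul, ENNReal.toReal_ofReal (abs_nonneg _),
      ENNReal.toReal_ofReal (inv_nonneg.2 (Finset.prod_nonneg fun k _ => (hX k).le)),
      div_eq_mul_inv]
    · exact MeasurableSet.univ_pi fun _ => measurableSet_Ioi
    · filter_upwards [hae] with l hl
      have : G.mulVec l ∈ {y : Fin (n + 1) → ℝ | 0 < y 0 ∧ (y 0)⁻¹ • Fin.tail y ∈ T} ↔
        ∀ k, 0 < l k := hcone l hl
      by_cases hc : ∀ k, 0 < l k
      · rw [Set.indicator_of_mem (this.2 hc), Set.indicator_of_mem (by simpa using hc), hpair]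
      · rw [Set.indicator_of_notMem (mt this.1 hc), Set.indicator_of_notMem (by simpa using hc)]
  · filter_upwards [ae_restrict_mem hTm] with a ha
    have := hpos a ha
    positivity
  · exact (Measurable.div (by fun_prop) (by fun_prop)).aestronglyMeasurable

theorem mem_convexHull_range_iff {ι E : Type*} [Fintype ι] [AddCommGroup E] [Module ℝ E]
    (v : ι → E) (x : E) : x ∈ convexHull ℝ (Set.range v) ↔
      ∃ l : ι → ℝ, (∀ i, 0 ≤ l i) ∧ ∑ i, l i = 1 ∧ x = ∑ i, l i • v i := by
  classical
  constructor
  · intro hx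
    have hlin : v = (Fintype.linearCombination ℝ v) ∘ fun i => Pi.single i 1 := by
      ext i
      simp
    rw [hlin, Set.range_comp, ← LinearMap.image_convexHull,
      convexHull_rangle_single_eq_stdSimplex] at hx
    obtain ⟨l, hl, rfl⟩ := hx
    exact ⟨l, hl.1, hl.2, by simp [Fintype.linearCombination_apply]⟩
  · rintro ⟨l, h0, h1, rfl⟩
    exact mem_convexHull_of_exists_fintype l v h0 h1 (fun i => Set.mem_range_self i) rfl

/-- The matrix whose columns are the points `w ℓ` preceded by a coordinate `1`. -/
def homogenizedMatrix {r : ℕ} (w : Fin (r + 1) → Fin r → ℝ) :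
    Matrix (Fin (r + 1)) (Fin (r + 1)) ℝ :=
  Matrix.of fun i ℓ => (Fin.cons 1 (w ℓ) : Fin (r + 1) → ℝ) i

theorem det_homogenizedMatrix_ne_zero {r : ℕ} {w : Fin (r + 1) → Fin r → ℝ}
    (hw : AffineIndependent ℝ w) : (homogenizedMatrix w).det ≠ 0 := by
  intro h
  obtain ⟨l, hl, h0⟩ := Matrix.exists_mulVec_eq_zero_iff.2 h
  refine hl (funext fun ℓ => ?_)
  refine affineIndependent_iff.1 hw Finset.univ l ?_ ?_ ℓ (Finset.mem_univ ℓ)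
  · simpa [homogenizedMatrix, Matrix.mulVec, dotProduct] using congrFun h0 0
  · ext i
    simpa [homogenizedMatrix, Matrix.mulVec, dotProduct, mul_comm] using congrFun h0 (Fin.succ i)

theorem factorial_mul_volume_convexHull {r : ℕ} {w : Fin (r + 1) → Fin r → ℝ}
    (hw : AffineIndependent ℝ w) :
    (r.factorial : ℝ) * (volume (convexHull ℝ (Set.range w))).toReal =
      |(homogenizedMatrix w).det| := by
  have h := integral_slice_simplicial_cone r (det_homogenizedMatrix_ne_zero hw)
    (fun k => by simp [homogenizedMatrix]) 0 (fun k => by simp [homogenizedMatrix])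
    (T := convexHull ℝ (Set.range w)) (fun a => by
      rw [mem_convexHull_range_iff]
      refine exists_congr fun l => and_congr_right fun _ => ?_
      constructor
      · rintro ⟨h1, rfl⟩
        ext i
        refine Fin.cases ?_ (fun i => ?_) i
        · simpa [homogenizedMatrix, Matrix.mulVec, dotProduct] using h1
        · simp [homogenizedMatrix, Matrix.mulVec, dotProduct, mul_comm]
      · intro h
        refine ⟨by simpa [homogenizedMatrix, Matrix.mulVec, dotProduct] using congrFun h 0, ?_⟩
        ext i
        simpa [homogenizedMatrix, Matrix.mulVec, dotProduct, mul_comm]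
          using (congrFun h (Fin.succ i)).symm)
  simpa [homogenizedMatrix, measureReal_def, mul_comm] using h

theorem simplex_contribution_general (n r : ℕ) (hrn : r ≤ n)
    (v : Fin (r + 1) → Fin n → ℝ) (hv : ∀ ℓ i, 0 ≤ v ℓ i)
    (e : Fin (n - r) → Fin n) (he : Function.Injective e)
    (p : Fin r → Fin n) (hp : Function.Injective p)
    (hpe : Set.range p = (Set.range e)ᶜ)
    (T : Set (Fin n → ℝ))
    (hT : T = {a | ∃ (l : Fin (r + 1) → ℝ) (m : Fin (n - r) → ℝ),
      (∀ ℓ, 0 ≤ l ℓ) ∧ (∀ j, 0 ≤ m j) ∧ ∑ ℓ, l ℓ = 1 ∧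
      a = (∑ ℓ, l ℓ • v ℓ) + ∑ j, m j • (fun i => if i = e j then (1 : ℝ) else 0)})
    (hdim : AffineIndependent ℝ (fun ℓ => (v ℓ) ∘ p))
    (X : Fin n → ℝ) (hX : ∀ i, 0 < X i) :
    ∫ a in T, ((n.factorial : ℝ) * ∏ i, X i) / (1 + ∑ i, a i * X i) ^ (n + 1)
    = ((r.factorial : ℝ)
        * (volume (convexHull ℝ (Set.range fun ℓ => (v ℓ) ∘ p))).toReal
        * ∏ i, X i) /
      ((∏ ℓ, (1 + ∑ i, v ℓ i * X i)) * ∏ j, X (e j)) := by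
  have hpne : ∀ i j, p i ≠ e j := fun i j h => by
    have : p i ∈ (Set.range e)ᶜ := hpe ▸ Set.mem_range_self i
    exact this ⟨j, h.symm⟩
  let f : Fin (r + 1) ⊕ Fin (n - r) → Fin (n + 1) :=
    Sum.elim (Fin.cons 0 fun i => (p i).succ) fun j => (e j).succ
  have hfinj : Function.Injective f := by
    refine Function.Injective.sumElim ?_ ?_ ?_
    · refine Fin.cons_injective_iff.2 ⟨?_, (Fin.succ_injective n).comp hp⟩
      rintro ⟨i, hi⟩
      exact Fin.succ_ne_zero _ hi
    · exact (Fin.succ_injective n).comp he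
    · intro a b
      refine Fin.cases ?_ (fun i => ?_) a
      · simpa using (Fin.succ_ne_zero _).symm
      · simpa using hpne i b
  let ρ : Fin (r + 1) ⊕ Fin (n - r) ≃ Fin (n + 1) := Equiv.ofBijective f
    ((Fintype.bijective_iff_injective_and_card f).2 ⟨hfinj, by simp; omega⟩)
  have hρ0 : ρ (.inl 0) = 0 := rfl
  have hρp : ∀ i, ρ (.inl (Fin.succ i)) = (p i).succ := fun i => rfl
  have hρe : ∀ j, ρ (.inr j) = (e j).succ := fun j => rfl
  let c : Fin (r + 1) ⊕ Fin (n - r) → Fin (n + 1) → ℝ :=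
    Sum.elim (fun ℓ => Fin.cons 1 (v ℓ)) fun j => Fin.cons 0 fun i => if i = e j then 1 else 0
  let G : Matrix (Fin (n + 1)) (Fin (n + 1)) ℝ := Matrix.of fun i k => c (ρ.symm k) i
  have hGρ : ∀ i k, G i (ρ k) = c k i := fun i k => by simp [G]
  have hdet : G.det = (homogenizedMatrix fun ℓ => v ℓ ∘ p).det := by
    rw [← Matrix.det_submatrix_equiv_self ρ, show G.submatrix ρ ρ = Matrix.fromBlocks
      (homogenizedMatrix fun ℓ => v ℓ ∘ p) 0 (Matrix.of fun j ℓ => v ℓ (e j)) 1 from ?_,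
      Matrix.det_fromBlocks_zero₁₂, Matrix.det_one, mul_one]
    ext i k
    rw [Matrix.submatrix_apply, hGρ]
    rcases i with i | j <;> rcases k with ℓ | j'
    · refine Fin.cases ?_ (fun i => ?_) i
      · simp [hρ0, c, homogenizedMatrix]
      · simp [hρp, c, homogenizedMatrix]
    · refine Fin.cases ?_ (fun i => ?_) i
      · simp [hρ0, c]
      · simp [hρp, c, hpne]
    · simp [hρe, c]
    · simp [hρe, c, Matrix.one_apply, he.eq_iff]
  have hG : G.det ≠ 0 := hdet ▸ det_homogenizedMatrix_ne_zero hdim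
  have hG0 : ∀ k, 0 ≤ G 0 k := ρ.forall_congr_right.1 fun k => by
    rw [hGρ]
    rcases k with ℓ | j <;> simp [c]
  have hl : ∀ ℓ, G 0 (ρ (.inl ℓ)) + ∑ i, G (Fin.succ i) (ρ (.inl ℓ)) * X i =
      1 + ∑ i, v ℓ i * X i := fun ℓ => by simp [hGρ, c]
  have hr : ∀ j, G 0 (ρ (.inr j)) + ∑ i, G (Fin.succ i) (ρ (.inr j)) * X i = X (e j) :=
    fun j => by simp [hGρ, c]
  have hXG : ∀ k, 0 < G 0 k + ∑ i, G (Fin.succ i) k * X i := ρ.forall_congr_right.1 fun k => by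
    rcases k with ℓ | j
    · rw [hl]
      exact add_pos_of_pos_of_nonneg one_pos
        (Finset.sum_nonneg fun i _ => mul_nonneg (hv ℓ i) (hX i).le)
    · rw [hr]
      exact hX _
  have hTG : ∀ a, a ∈ T ↔ ∃ l : Fin (n + 1) → ℝ,
      (∀ k, 0 ≤ l k) ∧ G.mulVec l = (Fin.cons 1 a : Fin (n + 1) → ℝ) := by
    intro a
    have hmul : ∀ l : Fin (n + 1) → ℝ, G.mulVec l = (Fin.cons (∑ ℓ, l (ρ (.inl ℓ)))
        ((∑ ℓ, l (ρ (.inl ℓ)) • v ℓ) +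
          ∑ j, l (ρ (.inr j)) • (fun i => if i = e j then (1 : ℝ) else 0)) :
        Fin (n + 1) → ℝ) := fun l => by
      ext i
      rw [Matrix.mulVec, dotProduct, ← ρ.sum_comp, Fintype.sum_sum_type]
      simp only [hGρ]
      refine Fin.cases ?_ (fun i => ?_) i
      · simp [c]
      · simp [c, mul_comm]
    rw [hT]
    constructor
    · rintro ⟨l, m, hl0, hm0, h1, rfl⟩
      refine ⟨Sum.elim l m ∘ ρ.symm, ρ.forall_congr_right.1 fun k => ?_, ?_⟩
      · rcases k with ℓ | j
        · simpa using hl0 ℓ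
        · simpa using hm0 j
      · rw [hmul]
        simp [h1]
    · rintro ⟨l, hl0, h1⟩
      rw [hmul, Fin.cons_inj] at h1
      exact ⟨fun ℓ => l (ρ (.inl ℓ)), fun j => l (ρ (.inr j)), fun _ => hl0 _, fun _ => hl0 _,
        h1.1, h1.2.symm⟩
  have key := integral_slice_simplicial_cone n hG hG0 X hXG hTG
  rw [← ρ.prod_comp, Fintype.prod_sum_type] at key
  simp only [hl, hr] at key
  rw [hdet, ← factorial_mul_volume_convexHull hdim] at key
  simp_rw [mul_comm _ (∏ i, X i), mul_div_assoc]
  rw [integral_const_mul, key, mul_div_assoc]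
end
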